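/- For a strongly noetherian poset C, every element sequence is 'good': given any sequence (x_i)_{i∈ℕ} in C, the set of indices i such that {j : x_j ≤ x_i} is infinite is nonempty. -/

import Mathlib

open Set

/-- In a strongly noetherian poset (every ascending chain of sieves, i.e. lower sets,
stabilises), every sequence is good: there is an index `i` such that `x j ≤ x i` for
infinitely many `j`. -/
theorem good_sequence_of_stronglyNoetherian {C : Type*} [PartialOrder C]
    (h : ∀ D : ℕ →o LowerSet C, ∃ N, ∀ n, N ≤ n → D n = D N) :
    ∀ x : ℕ → C, {i : ℕ | {j : ℕ | x j ≤ x i}.Infinite}.Nonempty := by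
  intro x
  by_contra hne
  rw [Set.not_nonempty_iff_eq_empty] at hne
  have hfin : ∀ i, {j : ℕ | x j ≤ x i}.Finite := by
    intro i
    by_contra hi
    have hmem : i ∈ {i : ℕ | {j : ℕ | x j ≤ x i}.Infinite} := hi
    rw [hne] at hmem
    exact hmem
  let D : ℕ →o LowerSet C :=
    { toFun := fun n =>
        { carrier := {c | ∃ i, i ≤ n ∧ c ≤ x i}
          lower' := by
            rintro a b hba ⟨i, hi, hai⟩
            exact ⟨i, hi, hba.trans hai⟩ }
      monotone' := by
        rintro m n hmn c ⟨i, hi, hc⟩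
        exact ⟨i, hi.trans hmn, hc⟩ }
  obtain ⟨N, hN⟩ := h D
  have key : ∀ j, ∃ i, i ≤ N ∧ x j ≤ x i := by
    intro j
    have hj : x j ∈ D (max N j) := ⟨j, le_max_right _ _, le_rfl⟩
    rw [hN _ (le_max_left _ _)] at hj
    exact hj
  have hU : (⋃ i ∈ Set.Iic N, {j : ℕ | x j ≤ x i}).Finite :=
    (Set.finite_Iic N).biUnion fun i _ => hfin i
  refine Set.infinite_univ (α := ℕ) (hU.subset fun j _ => ?_)
  obtain ⟨i, hi, hij⟩ := key j
  exact Set.mem_biUnion (Set.mem_Iic.2 hi) hij
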